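/- For each n ∈ ℕ, BΣ_{n+2} proves WRΠ_{n+1}: every model of BΣ_{n+2} satisfies the weak regularity principle WRφ for every Π_{n+1} formula φ(x,y) with parameters. -/

import Mathlib

namespace PaperArith

/-! ## Syntax of (two-sorted) first-order arithmetic

Terms and formulas of arithmetic in the language `{0, 1, +, ·, <}`,
with number variables and (monadic second-order) set variables both indexed
by natural numbers.  Bounded quantifiers are taken as primitives, so that the
class `Δ₀` of bounded formulas is a purely syntactic class. -/

/-- Terms of first-order arithmetic in the language `{0, 1, +, ·, <}`. -/
inductive Term : Type
  | var : ℕ → Term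
  | zero : Term
  | one : Term
  | add : Term → Term → Term
  | mul : Term → Term → Term

/-- Formulas of (two-sorted) arithmetic.  `mem t i` is the atomic formula
`t ∈ Xᵢ`; `ball x t φ` is `∀ x < t, φ` and `bex x t φ` is `∃ x < t, φ`;
`sall i φ` and `sex i φ` quantify over the set variable `Xᵢ`.
Purely first-order formulas are those avoiding `mem`, `sall`, `sex`. -/
inductive Fml : Type
  | eq : Term → Term → Fml
  | lt : Term → Term → Fml
  | mem : Term → ℕ → Fml
  | not : Fml → Fml
  | and : Fml → Fml → Fml
  | or : Fml → Fml → Fml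
  | imp : Fml → Fml → Fml
  | all : ℕ → Fml → Fml
  | ex : ℕ → Fml → Fml
  | ball : ℕ → Term → Fml → Fml
  | bex : ℕ → Term → Fml → Fml
  | sall : ℕ → Fml → Fml
  | sex : ℕ → Fml → Fml

/-- A structure for the first-order language of arithmetic. -/
structure Str : Type 1 where
  M : Type
  zero : M
  one : M
  add : M → M → M
  mul : M → M → M
  lt : M → M → Prop

/-- Value of a term under a valuation of the number variables. -/
def tval (S : Str) (v : ℕ → S.M) : Term → S.M
  | .var i => v i
  | .zero => S.zero
  | .one => S.one
  | .add t u => S.add (tval S v t) (tval S v u)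
  | .mul t u => S.mul (tval S v t) (tval S v u)

/-- Update a valuation at one variable. -/
def upd {α : Type} (v : ℕ → α) (x : ℕ) (a : α) : ℕ → α :=
  fun i => if i = x then a else v i

/-- Tarskian satisfaction over the structure `S`, with second-order universe
`X` (set quantifiers range over `X`); `v` is the valuation of number
variables, `w` the valuation of set variables. -/
def Sat (S : Str) (X : Set (Set S.M)) : (ℕ → S.M) → (ℕ → Set S.M) → Fml → Prop
  | v, _, .eq t u => tval S v t = tval S v u
  | v, _, .lt t u => S.lt (tval S v t) (tval S v u)
  | v, w, .mem t i => tval S v t ∈ w i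
  | v, w, .not φ => ¬ Sat S X v w φ
  | v, w, .and φ ψ => Sat S X v w φ ∧ Sat S X v w ψ
  | v, w, .or φ ψ => Sat S X v w φ ∨ Sat S X v w ψ
  | v, w, .imp φ ψ => Sat S X v w φ → Sat S X v w ψ
  | v, w, .all x φ => ∀ m : S.M, Sat S X (upd v x m) w φ
  | v, w, .ex x φ => ∃ m : S.M, Sat S X (upd v x m) w φ
  | v, w, .ball x t φ => ∀ m : S.M, S.lt m (tval S v t) → Sat S X (upd v x m) w φ
  | v, w, .bex x t φ => ∃ m : S.M, S.lt m (tval S v t) ∧ Sat S X (upd v x m) w φ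
  | v, w, .sall i φ => ∀ A : Set S.M, A ∈ X → Sat S X v (upd w i A) φ
  | v, w, .sex i φ => ∃ A : Set S.M, A ∈ X ∧ Sat S X v (upd w i A) φ

/-- First-order satisfaction (for purely first-order formulas the second-order
data is irrelevant). -/
def Sat0 (S : Str) (v : ℕ → S.M) (φ : Fml) : Prop :=
  Sat S ∅ v (fun _ => ∅) φ

/-! ## The arithmetic hierarchy -/

/-- `Δ₀` formulas: purely first-order, only bounded quantifiers. -/
inductive Delta0 : Fml → Prop
  | eq (t u : Term) : Delta0 (.eq t u)
  | lt (t u : Term) : Delta0 (.lt t u)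
  | not {φ : Fml} : Delta0 φ → Delta0 (.not φ)
  | and {φ ψ : Fml} : Delta0 φ → Delta0 ψ → Delta0 (.and φ ψ)
  | or {φ ψ : Fml} : Delta0 φ → Delta0 ψ → Delta0 (.or φ ψ)
  | imp {φ ψ : Fml} : Delta0 φ → Delta0 ψ → Delta0 (.imp φ ψ)
  | ball (x : ℕ) (t : Term) {φ : Fml} : Delta0 φ → Delta0 (.ball x t φ)
  | bex (x : ℕ) (t : Term) {φ : Fml} : Delta0 φ → Delta0 (.bex x t φ)

mutual
  /-- `Σₙ` formulas of the first-order arithmetic hierarchy. -/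
  inductive IsSigma : ℕ → Fml → Prop
    | delta0 {n : ℕ} {φ : Fml} : Delta0 φ → IsSigma n φ
    | ofPi {n : ℕ} {φ : Fml} : IsPi n φ → IsSigma (n + 1) φ
    | ex (x : ℕ) {n : ℕ} {φ : Fml} : IsSigma (n + 1) φ → IsSigma (n + 1) (.ex x φ)
  /-- `Πₙ` formulas of the first-order arithmetic hierarchy. -/
  inductive IsPi : ℕ → Fml → Prop
    | delta0 {n : ℕ} {φ : Fml} : Delta0 φ → IsPi n φ
    | ofSigma {n : ℕ} {φ : Fml} : IsSigma n φ → IsPi (n + 1) φ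
    | all (x : ℕ) {n : ℕ} {φ : Fml} : IsPi (n + 1) φ → IsPi (n + 1) (.all x φ)
end

/-- `Σ₀(Σₙ)`: the closure of `Σₙ` under Boolean operations and bounded
quantification. -/
inductive Sigma0Sigma (n : ℕ) : Fml → Prop
  | ofSigma {φ : Fml} : IsSigma n φ → Sigma0Sigma n φ
  | not {φ : Fml} : Sigma0Sigma n φ → Sigma0Sigma n (.not φ)
  | and {φ ψ : Fml} : Sigma0Sigma n φ → Sigma0Sigma n ψ → Sigma0Sigma n (.and φ ψ)
  | or {φ ψ : Fml} : Sigma0Sigma n φ → Sigma0Sigma n ψ → Sigma0Sigma n (.or φ ψ)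
  | imp {φ ψ : Fml} : Sigma0Sigma n φ → Sigma0Sigma n ψ → Sigma0Sigma n (.imp φ ψ)
  | ball (x : ℕ) (t : Term) {φ : Fml} : Sigma0Sigma n φ → Sigma0Sigma n (.ball x t φ)
  | bex (x : ℕ) (t : Term) {φ : Fml} : Sigma0Sigma n φ → Sigma0Sigma n (.bex x t φ)

/-- The class `Σₙ ∧ Πₙ` of conjunctions of a `Σₙ` and a `Πₙ` formula. -/
def SigmaAndPi (n : ℕ) (φ : Fml) : Prop :=
  ∃ ψ χ : Fml, IsSigma n ψ ∧ IsPi n χ ∧ φ = Fml.and ψ χ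

/-- The class `Σₙ ∨ Πₙ` of disjunctions of a `Σₙ` and a `Πₙ` formula. -/
def SigmaOrPi (n : ℕ) (φ : Fml) : Prop :=
  ∃ ψ χ : Fml, IsSigma n ψ ∧ IsPi n χ ∧ φ = Fml.or ψ χ

/-- `Δ₀⁰` formulas of second-order arithmetic: only bounded first-order
quantifiers; free set variables (set parameters) are allowed. -/
inductive Delta0SO : Fml → Prop
  | eq (t u : Term) : Delta0SO (.eq t u)
  | lt (t u : Term) : Delta0SO (.lt t u)
  | mem (t : Term) (i : ℕ) : Delta0SO (.mem t i)
  | not {φ : Fml} : Delta0SO φ → Delta0SO (.not φ)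
  | and {φ ψ : Fml} : Delta0SO φ → Delta0SO ψ → Delta0SO (.and φ ψ)
  | or {φ ψ : Fml} : Delta0SO φ → Delta0SO ψ → Delta0SO (.or φ ψ)
  | imp {φ ψ : Fml} : Delta0SO φ → Delta0SO ψ → Delta0SO (.imp φ ψ)
  | ball (x : ℕ) (t : Term) {φ : Fml} : Delta0SO φ → Delta0SO (.ball x t φ)
  | bex (x : ℕ) (t : Term) {φ : Fml} : Delta0SO φ → Delta0SO (.bex x t φ)

mutual
  /-- `Σₙ⁰` formulas of the second-order arithmetic hierarchy
  (set parameters allowed, no set quantifiers). -/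
  inductive SigmaSO : ℕ → Fml → Prop
    | delta0 {n : ℕ} {φ : Fml} : Delta0SO φ → SigmaSO n φ
    | ofPi {n : ℕ} {φ : Fml} : PiSO n φ → SigmaSO (n + 1) φ
    | ex (x : ℕ) {n : ℕ} {φ : Fml} : SigmaSO (n + 1) φ → SigmaSO (n + 1) (.ex x φ)
  /-- `Πₙ⁰` formulas of the second-order arithmetic hierarchy. -/
  inductive PiSO : ℕ → Fml → Prop
    | delta0 {n : ℕ} {φ : Fml} : Delta0SO φ → PiSO n φ
    | ofSigma {n : ℕ} {φ : Fml} : SigmaSO n φ → PiSO (n + 1) φ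
    | all (x : ℕ) {n : ℕ} {φ : Fml} : PiSO (n + 1) φ → PiSO (n + 1) (.all x φ)
end

/-! ## First-order theories -/

/-- `PA⁻`: the theory of non-negative parts of discretely ordered rings. -/
structure PAminus (S : Str) : Prop where
  add_assoc : ∀ a b c, S.add (S.add a b) c = S.add a (S.add b c)
  add_comm : ∀ a b, S.add a b = S.add b a
  mul_assoc : ∀ a b c, S.mul (S.mul a b) c = S.mul a (S.mul b c)
  mul_comm : ∀ a b, S.mul a b = S.mul b a
  distrib : ∀ a b c, S.mul a (S.add b c) = S.add (S.mul a b) (S.mul a c)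
  add_zero : ∀ a, S.add a S.zero = a
  mul_zero : ∀ a, S.mul a S.zero = S.zero
  mul_one : ∀ a, S.mul a S.one = a
  lt_irrefl : ∀ a, ¬ S.lt a a
  lt_trans : ∀ a b c, S.lt a b → S.lt b c → S.lt a c
  lt_total : ∀ a b, S.lt a b ∨ a = b ∨ S.lt b a
  add_lt_add : ∀ a b c, S.lt a b → S.lt (S.add a c) (S.add b c)
  mul_lt_mul : ∀ a b c, S.lt a b → S.lt S.zero c → S.lt (S.mul a c) (S.mul b c)
  zero_lt_one : S.lt S.zero S.one
  zero_le : ∀ a, a = S.zero ∨ S.lt S.zero a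
  discrete : ∀ a b, S.lt a b → S.add a S.one = b ∨ S.lt (S.add a S.one) b
  pred : ∀ a, S.lt S.zero a → ∃ b, S.add b S.one = a
  sub : ∀ a b, S.lt a b → ∃ c, S.add a c = b

/-- The induction scheme for the class `Γ` of formulas
(parameters are allowed via the ambient valuation `v`). -/
def IndFor (S : Str) (Γ : Fml → Prop) : Prop :=
  ∀ φ : Fml, Γ φ → ∀ (v : ℕ → S.M) (x : ℕ),
    Sat0 S (upd v x S.zero) φ →
    (∀ m, Sat0 S (upd v x m) φ → Sat0 S (upd v x (S.add m S.one)) φ) →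
    ∀ m, Sat0 S (upd v x m) φ

/-- The collection scheme for the class `Γ`:
`(∀ x < a ∃ y φ) → (∃ b ∀ x < a ∃ y < b φ)`. -/
def CollFor (S : Str) (Γ : Fml → Prop) : Prop :=
  ∀ φ : Fml, Γ φ → ∀ (v : ℕ → S.M) (x y : ℕ), x ≠ y → ∀ a : S.M,
    (∀ m, S.lt m a → ∃ k, Sat0 S (upd (upd v x m) y k) φ) →
    ∃ b, ∀ m, S.lt m a → ∃ k, S.lt k b ∧ Sat0 S (upd (upd v x m) y k) φ

/-- `IΔ₀` (over `PA⁻`). -/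
def IDelta0 (S : Str) : Prop := PAminus S ∧ IndFor S Delta0

/-- `IΣₙ` (over `PA⁻`; note `Δ₀ ⊆ Σₙ`, so this includes `IΔ₀`). -/
def ISigma (S : Str) (n : ℕ) : Prop := PAminus S ∧ IndFor S (IsSigma n)

/-- `BΣₙ`: the `Σₙ`-collection scheme, including `IΔ₀` (over `PA⁻`). -/
def BSigma (S : Str) (n : ℕ) : Prop := IDelta0 S ∧ CollFor S (IsSigma n)

/-- The weak regularity principle `WRφ` for all `φ` in the class `Γ`:
the universal closure of `(∀ x ∃ y < a φ(x,y)) → (∃ y < a ∀ b ∃ x > b φ(x,y))`.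
Here `x, y` are the two displayed variables and all other free variables of
`φ` are parameters, interpreted by the ambient valuation `v`. -/
def WRFor (S : Str) (Γ : Fml → Prop) : Prop :=
  ∀ φ : Fml, Γ φ → ∀ (v : ℕ → S.M) (x y : ℕ), x ≠ y → ∀ a : S.M,
    (∀ m, ∃ k, S.lt k a ∧ Sat0 S (upd (upd v x m) y k) φ) →
    ∃ k, S.lt k a ∧ ∀ b, ∃ m, S.lt b m ∧ Sat0 S (upd (upd v x m) y k) φ

/-! ## Second-order theories -/

/-- Second-order induction scheme for the class `Γ`, with set parameters
from the second-order universe `X`. -/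
def IndForSO (S : Str) (X : Set (Set S.M)) (Γ : Fml → Prop) : Prop :=
  ∀ φ : Fml, Γ φ → ∀ (v : ℕ → S.M) (w : ℕ → Set S.M), (∀ i, w i ∈ X) → ∀ x : ℕ,
    Sat S X (upd v x S.zero) w φ →
    (∀ m, Sat S X (upd v x m) w φ → Sat S X (upd v x (S.add m S.one)) w φ) →
    ∀ m, Sat S X (upd v x m) w φ

/-- Second-order collection scheme for the class `Γ`. -/
def CollForSO (S : Str) (X : Set (Set S.M)) (Γ : Fml → Prop) : Prop :=
  ∀ φ : Fml, Γ φ → ∀ (v : ℕ → S.M) (w : ℕ → Set S.M), (∀ i, w i ∈ X) →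
    ∀ (x y : ℕ), x ≠ y → ∀ a : S.M,
    (∀ m, S.lt m a → ∃ k, Sat S X (upd (upd v x m) y k) w φ) →
    ∃ b, ∀ m, S.lt m a → ∃ k, S.lt k b ∧ Sat S X (upd (upd v x m) y k) w φ

/-- `Δ₁⁰`-comprehension. -/
def Delta1CA (S : Str) (X : Set (Set S.M)) : Prop :=
  ∀ φ ψ : Fml, SigmaSO 1 φ → PiSO 1 ψ →
    ∀ (v : ℕ → S.M) (w : ℕ → Set S.M), (∀ i, w i ∈ X) → ∀ x : ℕ,
    (∀ m, Sat S X (upd v x m) w φ ↔ Sat S X (upd v x m) w ψ) →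
    ∃ A ∈ X, ∀ m, m ∈ A ↔ Sat S X (upd v x m) w φ

/-- `Σₙ`-comprehension for first-order formulas with parameters from `M`. -/
def SigmaCA (S : Str) (X : Set (Set S.M)) (n : ℕ) : Prop :=
  ∀ φ : Fml, IsSigma n φ → ∀ (v : ℕ → S.M) (x : ℕ),
    ∃ A ∈ X, ∀ m, m ∈ A ↔ Sat0 S (upd v x m) φ

/-- `RCA₀`. -/
def RCA0 (S : Str) (X : Set (Set S.M)) : Prop :=
  PAminus S ∧ IndForSO S X (SigmaSO 1) ∧ Delta1CA S X

/-- `Σ₁⁰`-separation; over `RCA₀` this is equivalent to weak Kőnig's lemma. -/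
def Sigma1Sep (S : Str) (X : Set (Set S.M)) : Prop :=
  ∀ φ ψ : Fml, SigmaSO 1 φ → SigmaSO 1 ψ →
    ∀ (v : ℕ → S.M) (w : ℕ → Set S.M), (∀ i, w i ∈ X) → ∀ x : ℕ,
    (∀ m, ¬ (Sat S X (upd v x m) w φ ∧ Sat S X (upd v x m) w ψ)) →
    ∃ A ∈ X, ∀ m, (Sat S X (upd v x m) w φ → m ∈ A) ∧ (m ∈ A → ¬ Sat S X (upd v x m) w ψ)

/-- `WKL₀`, rendered as `RCA₀` plus `Σ₁⁰`-separation (which is equivalent,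
over `RCA₀`, to weak Kőnig's lemma). -/
def WKL0 (S : Str) (X : Set (Set S.M)) : Prop := RCA0 S X ∧ Sigma1Sep S X

/-- `BΣₙ⁰`: the second-order `Σₙ⁰`-collection scheme (including `IΔ₀⁰`,
over `PA⁻`). -/
def BSigmaSO (S : Str) (X : Set (Set S.M)) (n : ℕ) : Prop :=
  PAminus S ∧ IndForSO S X Delta0SO ∧ CollForSO S X (SigmaSO n)

/-- `IΣₙ⁰`: the second-order `Σₙ⁰`-induction scheme, over `RCA₀`. -/
def ISigmaSO (S : Str) (X : Set (Set S.M)) (n : ℕ) : Prop :=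
  RCA0 S X ∧ IndForSO S X (SigmaSO n)

/-! ## Exponentiation and binary digits -/

/-- Satisfaction of a three-variable formula `E(x₀, x₁, x₂)` at `(a, b, c)`. -/
def ExpAt (S : Str) (E : Fml) (a b c : S.M) : Prop :=
  Sat0 S (fun i => if i = 0 then a else if i = 1 then b else c) E

/-- `E(x₀,x₁,x₂)` is a `Δ₀` definition of the (total) exponentiation function
`x₀ ^ x₁ = x₂`.  The existence of such an `E` expresses `exp`
(the totality of exponentiation). -/
structure IsExpDef (S : Str) (E : Fml) : Prop where
  delta0 : Delta0 E
  base : ∀ a, ExpAt S E a S.zero S.one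
  total : ∀ a b, ∃ c, ExpAt S E a b c
  unique : ∀ a b c c', ExpAt S E a b c → ExpAt S E a b c' → c = c'
  step : ∀ a b c, ExpAt S E a b c → ExpAt S E a (S.add b S.one) (S.mul c a)

/-- `exp`: the totality of exponentiation (via a `Δ₀` definition of its
graph). -/
def SatExp (S : Str) : Prop := ∃ E : Fml, IsExpDef S E

/-! ## Embeddings, end extensions and elementarity -/

/-- An embedding of arithmetic structures. -/
structure Emb (S K : Str) where
  j : S.M → K.M
  inj : Function.Injective j
  zero : j S.zero = K.zero
  one : j S.one = K.one
  add : ∀ a b, j (S.add a b) = K.add (j a) (j b)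
  mul : ∀ a b, j (S.mul a b) = K.mul (j a) (j b)
  lt_iff : ∀ a b, S.lt a b ↔ K.lt (j a) (j b)

/-- The extension along `e` is an end extension: every element of `K` not in
the image of `M` exceeds every element of `M`. -/
def IsEndExt {S K : Str} (e : Emb S K) : Prop :=
  ∀ b : K.M, b ∉ Set.range e.j → ∀ a : S.M, K.lt (e.j a) b

/-- The extension along `e` is proper. -/
def IsProper {S K : Str} (e : Emb S K) : Prop := ¬ Function.Surjective e.j

/-- The extension along `e` is `Σₙ`-elementary: all `Σₙ` formulas with
parameters from `M` are absolute between `M` and `K`. -/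
def SigmaElem {S K : Str} (e : Emb S K) (n : ℕ) : Prop :=
  ∀ φ : Fml, IsSigma n φ → ∀ v : ℕ → S.M,
    (Sat0 S v φ ↔ Sat0 K (fun i => e.j (v i)) φ)

/-- `K ⊨ M‑IΣₙ` (for an extension `e : M → K`): induction up to any `a ∈ M`
for `Σₙ` formulas with parameters from `K`. -/
def MISigma {S K : Str} (e : Emb S K) (n : ℕ) : Prop :=
  ∀ φ : Fml, IsSigma n φ → ∀ (v : ℕ → K.M) (x : ℕ) (a : S.M),
    Sat0 K (upd v x K.zero) φ →
    (∀ m, K.lt m (e.j a) → (Sat0 K (upd v x m) φ → Sat0 K (upd v x (K.add m K.one)) φ)) →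
    ∀ m, K.lt m (e.j a) → Sat0 K (upd v x m) φ

/-- The `x`-th binary digit of `c ∈ K` is `1`, computed via a `Δ₀` definition
`E` of exponentiation on the ground model `S` (here `x` lies under the image
of `S`): there are `x', p ∈ M` with `j x' = x`, `p = 2 ^ x'`, and `u, v ∈ K`
with `c = u·(2p) + p + v` and `v < p`. -/
def BitVia {S K : Str} (e : Emb S K) (E : Fml) (x c : K.M) : Prop :=
  ∃ x' p : S.M, e.j x' = x ∧ ExpAt S E (S.add S.one S.one) x' p ∧
    ∃ u v : K.M, K.lt v (e.j p) ∧
      c = K.add (K.add (K.mul u (K.add (e.j p) (e.j p))) (e.j p)) v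

/-! ## The second-order restricted ultrapower -/

/-- `A` is cofinal (unbounded) in `S`. -/
def Cofinal (S : Str) (A : Set S.M) : Prop := ∀ b : S.M, ∃ x ∈ A, S.lt b x

/-- The pairing term `⟨x, y⟩ = (x + y)·(x + y) + x`. -/
def pairS (S : Str) (x y : S.M) : S.M := S.add (S.mul (S.add x y) (S.add x y)) x

/-- The graph of `f : M → M`, coded as a subset of `M` via pairing. -/
def graphOf (S : Str) (f : S.M → S.M) : Set S.M := {m | ∃ x, m = pairS S x (f x)}

/-- `f` is a total function `M → M` lying in the second-order universe `X`
(its coded graph belongs to `X`).  The collection of such `f` is the class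
`ℱ` of the restricted ultrapower. -/
def FuncIn (S : Str) (X : Set (Set S.M)) (f : S.M → S.M) : Prop := graphOf S f ∈ X

/-- `U` is an ultrafilter on the Boolean algebra `X`, all of whose elements
are cofinal in `M`. -/
structure UltraOn (S : Str) (X U : Set (Set S.M)) : Prop where
  subset : U ⊆ X
  univ_mem : Set.univ ∈ U
  empty_not_mem : ∅ ∉ U
  inter_mem : ∀ A ∈ U, ∀ B ∈ U, A ∩ B ∈ U
  superset_mem : ∀ A ∈ U, ∀ B ∈ X, A ⊆ B → B ∈ U
  ultra : ∀ A ∈ X, A ∈ U ∨ Aᶜ ∈ U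
  cofinal : ∀ A ∈ U, Cofinal S A

/-- A realization of the second-order restricted ultrapower `ℱ/𝒰` of `S`
with respect to the second-order universe `X` and the ultrafilter `U`:
a structure `K` whose elements are exactly the classes `cls f hf = [f]` of
total functions `f ∈ ℱ`, where `[f] = [g]` iff `f = g` on a set in `U`, with
pointwise arithmetic operations, order decided by `U`, and the inherited
second-order membership relation `memK` serving as the second-order expansion. -/
structure RUP (S : Str) (X U : Set (Set S.M)) : Type 1 where
  K : Str
  cls : (f : S.M → S.M) → FuncIn S X f → K.M
  memK : K.M → Set S.M → Prop
  const_in : ∀ a : S.M, FuncIn S X (fun _ => a)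
  surj : ∀ b : K.M, ∃ (f : S.M → S.M) (hf : FuncIn S X f), cls f hf = b
  eq_iff : ∀ (f : S.M → S.M) (hf : FuncIn S X f) (g : S.M → S.M) (hg : FuncIn S X g),
      (cls f hf = cls g hg) ↔ {i : S.M | f i = g i} ∈ U
  lt_iff : ∀ (f : S.M → S.M) (hf : FuncIn S X f) (g : S.M → S.M) (hg : FuncIn S X g),
      K.lt (cls f hf) (cls g hg) ↔ {i : S.M | S.lt (f i) (g i)} ∈ U
  zero_eq : K.zero = cls (fun _ => S.zero) (const_in S.zero)
  one_eq : K.one = cls (fun _ => S.one) (const_in S.one)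
  add_eq : ∀ (f : S.M → S.M) (hf : FuncIn S X f) (g : S.M → S.M) (hg : FuncIn S X g)
      (h : S.M → S.M) (hh : FuncIn S X h), (∀ i, h i = S.add (f i) (g i)) →
      K.add (cls f hf) (cls g hg) = cls h hh
  mul_eq : ∀ (f : S.M → S.M) (hf : FuncIn S X f) (g : S.M → S.M) (hg : FuncIn S X g)
      (h : S.M → S.M) (hh : FuncIn S X h), (∀ i, h i = S.mul (f i) (g i)) →
      K.mul (cls f hf) (cls g hg) = cls h hh
  mem_iff : ∀ (f : S.M → S.M) (hf : FuncIn S X f) (A : Set S.M), A ∈ X →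
      (memK (cls f hf) A ↔ {i : S.M | f i ∈ A} ∈ U)

/-- The canonical embedding `M → ℱ/𝒰` via constant functions. -/
def RUP.emb {S : Str} {X U : Set (Set S.M)} (R : RUP S X U) (a : S.M) : R.K.M :=
  R.cls (fun _ => a) (R.const_in a)

/-- The subset of `ℱ/𝒰` induced by `A ⊆ M`. -/
def RUP.setImg {S : Str} {X U : Set (Set S.M)} (R : RUP S X U) (A : Set S.M) :
    Set R.K.M := {b | R.memK b A}

/-- The second-order part of the expanded ultrapower `(ℱ/𝒰, 𝒳)`:
the (injected) copy of `X`. -/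
def RUP.X2 {S : Str} {X U : Set (Set S.M)} (R : RUP S X U) : Set (Set R.K.M) :=
  (fun A => R.setImg A) '' X

end PaperArith

namespace PaperArith

/-! ## Semantic arithmetic hierarchy -/

section Hierarchy

variable {M : Type}

/-- Prepend a value to a valuation. -/
def cons (a : M) (v : ℕ → M) : ℕ → M
  | 0 => a
  | i + 1 => v i

variable [CommSemiring M]

/-- Polynomial functions with coefficients in `ℕ`, i.e. the functions defined by terms. -/
inductive Poly : ((ℕ → M) → M) → Prop
  | var (i : ℕ) : Poly fun v => v i
  | zero : Poly fun _ => 0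
  | one : Poly fun _ => 1
  | add {f g : (ℕ → M) → M} : Poly f → Poly g → Poly fun v => f v + g v
  | mul {f g : (ℕ → M) → M} : Poly f → Poly g → Poly fun v => f v * g v

theorem Poly.comp {f : (ℕ → M) → M} (hf : Poly f) {σ : (ℕ → M) → ℕ → M}
    (hσ : ∀ i, Poly fun v => σ v i) : Poly fun v => f (σ v) := by
  induction hf with
  | var i => exact hσ i
  | zero => exact .zero
  | one => exact .one
  | add _ _ hf hg => exact .add hf hg
  | mul _ _ hf hg => exact .mul hf hg

theorem Poly.tail {f : (ℕ → M) → M} (hf : Poly f) : Poly fun w => f fun i => w (i + 1) :=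
  hf.comp fun i => .var (i + 1)

theorem Poly.cons {f : (ℕ → M) → M} {σ : (ℕ → M) → ℕ → M} (hf : Poly f)
    (hσ : ∀ i, Poly fun v => σ v i) : ∀ i, Poly fun v => cons (f v) (σ v) i
  | 0 => hf
  | i + 1 => hσ i

variable [LinearOrder M]

/-- Relations on valuations defined by bounded formulas. -/
inductive BddDef : ((ℕ → M) → Prop) → Prop
  | eq {f g : (ℕ → M) → M} : Poly f → Poly g → BddDef fun v => f v = g v
  | lt {f g : (ℕ → M) → M} : Poly f → Poly g → BddDef fun v => f v < g v
  | not {R : (ℕ → M) → Prop} : BddDef R → BddDef fun v => ¬ R v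
  | and {R Q : (ℕ → M) → Prop} : BddDef R → BddDef Q → BddDef fun v => R v ∧ Q v
  | bex {t : (ℕ → M) → M} {R : (ℕ → M) → Prop} : Poly t → BddDef R →
      BddDef fun v => ∃ x, x < t v ∧ R (cons x v)

theorem BddDef.comp {R : (ℕ → M) → Prop} (hR : BddDef R) {σ : (ℕ → M) → ℕ → M}
    (hσ : ∀ i, Poly fun v => σ v i) : BddDef fun v => R (σ v) := by
  induction hR generalizing σ with
  | eq hf hg => exact .eq (hf.comp hσ) (hg.comp hσ)
  | lt hf hg => exact .lt (hf.comp hσ) (hg.comp hσ)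
  | not _ ih => exact .not (ih hσ)
  | and _ _ ih₁ ih₂ => exact .and (ih₁ hσ) (ih₂ hσ)
  | bex ht _ ih =>
    exact .bex (ht.comp hσ) (ih (σ := fun w => cons (w 0) (σ fun i => w (i + 1)))
      (Poly.cons (.var 0) fun i => (hσ i).tail))

/-- Relations on valuations defined by `Σₖ` formulas with contracted quantifiers. -/
def SigmaDef : ℕ → ((ℕ → M) → Prop) → Prop
  | 0, R => BddDef R
  | k + 1, R => ∃ Q, SigmaDef k Q ∧ R = fun v => ∃ x, ¬ Q (cons x v)

theorem SigmaDef.comp {k : ℕ} {R : (ℕ → M) → Prop} (hR : SigmaDef k R)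
    {σ : (ℕ → M) → ℕ → M} (hσ : ∀ i, Poly fun v => σ v i) :
    SigmaDef k fun v => R (σ v) := by
  induction k generalizing R σ with
  | zero => exact BddDef.comp hR hσ
  | succ k ih =>
    obtain ⟨Q, hQ, rfl⟩ := hR
    exact ⟨_, ih hQ (σ := fun w => cons (w 0) (σ fun i => w (i + 1)))
      (Poly.cons (.var 0) fun i => (hσ i).tail), rfl⟩

theorem SigmaDef.tail {k : ℕ} {R : (ℕ → M) → Prop} (hR : SigmaDef k R) :
    SigmaDef k fun w => R fun i => w (i + 1) :=
  hR.comp fun i => .var (i + 1)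

theorem SigmaDef.not_succ {k : ℕ} {R : (ℕ → M) → Prop} (hR : SigmaDef k R) :
    SigmaDef (k + 1) fun v => ¬ R v :=
  ⟨_, hR.tail, funext fun _ => propext (exists_const M).symm⟩

theorem SigmaDef.succ {k : ℕ} {R : (ℕ → M) → Prop} (hR : SigmaDef k R) :
    SigmaDef (k + 1) R := by
  induction k generalizing R with
  | zero => simpa using SigmaDef.not_succ (k := 0) (BddDef.not hR)
  | succ k ih =>
    obtain ⟨Q, hQ, rfl⟩ := hR
    exact ⟨Q, ih hQ, rfl⟩

theorem SigmaDef.mono {k l : ℕ} {R : (ℕ → M) → Prop} (hR : SigmaDef k R) (h : k ≤ l) :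
    SigmaDef l R := by
  induction h with
  | refl => exact hR
  | step _ ih => exact ih.succ

variable (M) in
/-- Collection for relations in `SigmaDef k`. -/
def Collection (k : ℕ) : Prop :=
  ∀ R : (ℕ → M) → Prop, SigmaDef k R → ∀ (v : ℕ → M) (a : M),
    (∀ x < a, ∃ y, R (cons y (cons x v))) → ∃ b, ∀ x < a, ∃ y < b, R (cons y (cons x v))

variable (M) in
/-- Induction for bounded relations. -/
def BddInduction : Prop :=
  ∀ R : (ℕ → M) → Prop, BddDef R → ∀ v : ℕ → M, R (cons 0 v) →
    (∀ x, R (cons x v) → R (cons (x + 1) v)) → ∀ x, R (cons x v)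

theorem Collection.mono {k l : ℕ} (h : Collection M l) (hkl : k ≤ l) : Collection M k :=
  fun R hR => h R (hR.mono hkl)

theorem BddDef.or {R Q : (ℕ → M) → Prop} (hR : BddDef R) (hQ : BddDef Q) :
    BddDef fun v => R v ∨ Q v := by
  simpa [or_iff_not_and_not] using (hR.not.and hQ.not).not

/-- Closure of a class of relations under monotone connectives and bounded quantifiers. -/
structure BddClosed (C : ((ℕ → M) → Prop) → Prop) : Prop where
  and {R Q : (ℕ → M) → Prop} : C R → C Q → C fun v => R v ∧ Q v
  or {R Q : (ℕ → M) → Prop} : C R → C Q → C fun v => R v ∨ Q v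
  bex {t : (ℕ → M) → M} {P : M → (ℕ → M) → Prop} : Poly t →
    C (fun w => P (w 0) fun i => w (i + 1)) → C fun v => ∃ x, x < t v ∧ P x v
  ball {t : (ℕ → M) → M} {P : M → (ℕ → M) → Prop} : Poly t →
    C (fun w => P (w 0) fun i => w (i + 1)) → C fun v => ∀ x, x < t v → P x v

theorem BddDef.bddClosed : BddClosed (BddDef (M := M)) where
  and := .and
  or := .or
  bex := .bex
  ball {t P} ht hP := by
    have h : BddDef fun v => ¬ ∃ x, x < t v ∧ ¬ P x v := .not (.bex ht hP.not)
    simpa only [not_exists, not_and, not_not] using h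

/-- Relations in `SigmaDef k` whose negation is also in `SigmaDef k`. -/
def DeltaDef (k : ℕ) (R : (ℕ → M) → Prop) : Prop :=
  SigmaDef k R ∧ SigmaDef k fun v => ¬ R v

theorem SigmaDef.delta {k : ℕ} {R : (ℕ → M) → Prop} (hR : SigmaDef k R) : DeltaDef (k + 1) R :=
  ⟨hR.succ, hR.not_succ⟩

theorem DeltaDef.not {k : ℕ} {R : (ℕ → M) → Prop} (hR : DeltaDef k R) :
    DeltaDef k fun v => ¬ R v :=
  ⟨hR.2, by simpa only [not_not] using hR.1⟩

theorem BddDef.delta (k : ℕ) {R : (ℕ → M) → Prop} (hR : BddDef R) : DeltaDef k R :=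
  ⟨SigmaDef.mono (k := 0) hR k.zero_le, SigmaDef.mono (k := 0) hR.not k.zero_le⟩

variable [IsStrictOrderedRing M] [SuccAddOrder M]

theorem SigmaDef.bddClosed {k : ℕ} (hC : Collection M k) : BddClosed (SigmaDef (M := M) k) := by
  induction k with
  | zero => exact BddDef.bddClosed
  | succ k ih =>
    have ih := ih (hC.mono k.le_succ)
    refine ⟨?_, ?_, ?_, ?_⟩
    · rintro _ _ ⟨Q₁, h₁, rfl⟩ ⟨Q₂, h₂, rfl⟩
      refine ⟨fun w => (∀ x, x < w 0 → Q₁ (cons x fun i => w (i + 1))) ∨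
        ∀ x, x < w 0 → Q₂ (cons x fun i => w (i + 1)),
        ih.or (ih.ball (.var 0) (h₁.comp (Poly.cons (.var 0) fun i => .var (i + 2))))
          (ih.ball (.var 0) (h₂.comp (Poly.cons (.var 0) fun i => .var (i + 2)))), ?_⟩
      funext v
      simp only [cons, not_or, not_forall, eq_iff_iff]
      constructor
      · rintro ⟨⟨x, hx⟩, y, hy⟩
        exact ⟨max x y + 1, ⟨x, Order.lt_add_one_iff.2 (le_max_left _ _), hx⟩,
          y, Order.lt_add_one_iff.2 (le_max_right _ _), hy⟩
      · rintro ⟨_, ⟨x, _, hx⟩, y, _, hy⟩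
        exact ⟨⟨x, hx⟩, y, hy⟩
    · rintro _ _ ⟨Q₁, h₁, rfl⟩ ⟨Q₂, h₂, rfl⟩
      exact ⟨_, ih.and h₁ h₂, by simp only [← exists_or, not_and_or]⟩
    · rintro t P ht ⟨Q, hQ, h⟩
      have hP : ∀ x v, P x v = ∃ y, ¬ Q (cons y (cons x v)) := fun x v => congrFun h (cons x v)
      refine ⟨fun w => ∀ x, x < t (fun i => w (i + 1)) → ∀ y, y < w 0 →
        Q (cons y (cons x fun i => w (i + 1))),
        ih.ball ht.tail (ih.ball (.var 1) (hQ.comp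
          (Poly.cons (.var 0) (Poly.cons (.var 1) fun i => .var (i + 3))))), ?_⟩
      funext v
      simp only [cons, not_forall, eq_iff_iff, hP]
      constructor
      · rintro ⟨x, hx, y, hy⟩
        exact ⟨y + 1, x, hx, y, Order.lt_add_one_iff.2 le_rfl, hy⟩
      · rintro ⟨_, x, hx, y, _, hy⟩
        exact ⟨x, hx, y, hy⟩
    · rintro t P ht ⟨Q, hQ, h⟩
      have hP : ∀ x v, P x v = ∃ y, ¬ Q (cons y (cons x v)) := fun x v => congrFun h (cons x v)
      refine ⟨fun w => ∃ x, x < t (fun i => w (i + 1)) ∧ ∀ y, y < w 0 →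
        Q (cons y (cons x fun i => w (i + 1))),
        ih.bex ht.tail (ih.ball (.var 1) (hQ.comp
          (Poly.cons (.var 0) (Poly.cons (.var 1) fun i => .var (i + 3))))), ?_⟩
      funext v
      simp only [cons, not_exists, not_and, not_forall, eq_iff_iff, hP]
      constructor
      · intro H
        obtain ⟨b, hb⟩ := hC _ hQ.not_succ v (t v) H
        exact ⟨b, fun x hx => by simpa using hb x hx⟩
      · rintro ⟨b, hb⟩ x hx
        obtain ⟨y, _, hy⟩ := hb x hx
        exact ⟨y, hy⟩

theorem SigmaDef.ex {k : ℕ} (hC : Collection M k) {P : M → (ℕ → M) → Prop}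
    (hP : SigmaDef (k + 1) fun w => P (w 0) fun i => w (i + 1)) :
    SigmaDef (k + 1) fun v => ∃ x, P x v := by
  obtain ⟨Q, hQ, h⟩ := hP
  have hP : ∀ x v, P x v = ∃ y, ¬ Q (cons y (cons x v)) := fun x v => congrFun h (cons x v)
  refine ⟨fun w => ∀ x, x < w 0 → ∀ y, y < w 0 → Q (cons y (cons x fun i => w (i + 1))),
    (bddClosed hC).ball (.var 0) ((bddClosed hC).ball (.var 1) (hQ.comp
      (Poly.cons (.var 0) (Poly.cons (.var 1) fun i => .var (i + 3))))), ?_⟩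
  funext v
  simp only [cons, not_forall, eq_iff_iff, hP]
  constructor
  · rintro ⟨x, y, hy⟩
    exact ⟨max x y + 1, x, Order.lt_add_one_iff.2 (le_max_left _ _),
      y, Order.lt_add_one_iff.2 (le_max_right _ _), hy⟩
  · rintro ⟨_, x, _, y, _, hy⟩
    exact ⟨x, y, hy⟩

theorem DeltaDef.bddClosed {k : ℕ} (hC : Collection M k) : BddClosed (DeltaDef (M := M) k) := by
  have h := SigmaDef.bddClosed hC
  refine ⟨fun hR hQ => ⟨h.and hR.1 hQ.1, ?_⟩, fun hR hQ => ⟨h.or hR.1 hQ.1, ?_⟩,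
    fun ht hP => ⟨h.bex ht hP.1, ?_⟩, fun ht hP => ⟨h.ball ht hP.1, ?_⟩⟩
  · simpa only [not_and_or] using h.or hR.2 hQ.2
  · simpa only [not_or] using h.and hR.2 hQ.2
  · simpa only [not_exists, not_and] using h.ball ht hP.2
  · simpa only [not_forall, exists_prop] using h.bex ht hP.2

theorem DeltaDef.imp {k : ℕ} (hC : Collection M k) {R Q : (ℕ → M) → Prop}
    (hR : DeltaDef k R) (hQ : DeltaDef k Q) : DeltaDef k fun v => R v → Q v := by
  simpa only [imp_iff_not_or] using (DeltaDef.bddClosed hC).or hR.not hQ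

theorem DeltaDef.iff {k : ℕ} (hC : Collection M k) {R Q : (ℕ → M) → Prop}
    (hR : DeltaDef k R) (hQ : DeltaDef k Q) : DeltaDef k fun v => (R v ↔ Q v) := by
  simpa only [iff_iff_implies_and_implies] using
    (DeltaDef.bddClosed hC).and (hR.imp hC hQ) (hQ.imp hC hR)

/-! ### Induction from collection -/

theorem SigmaDef.exists_below_of_bound {k : ℕ} (hC : Collection M k) {A : (ℕ → M) → Prop}
    (hA : SigmaDef k A) (v : ℕ → M) (m b : M)
    (hb : ∀ x < m, (∃ y, ¬ A (cons y (cons x v))) → ∃ y < b, ¬ A (cons y (cons x v))) :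
    ∃ Q, SigmaDef k Q ∧ ∃ u, ∀ x < m, (∃ y, ¬ A (cons y (cons x v))) ↔ ¬ Q (cons x u) := by
  refine ⟨fun w => ∀ y, y < w 1 → A (cons y (cons (w 0) fun i => w (i + 2))),
    (bddClosed hC).ball (.var 1)
      (hA.comp (Poly.cons (.var 0) (Poly.cons (.var 1) fun i => .var (i + 3)))),
    cons b v, fun x hx => ?_⟩
  simp only [cons, not_forall]
  constructor
  · intro h
    obtain ⟨y, hy, h⟩ := hb x hx h
    exact ⟨y, hy, h⟩
  · rintro ⟨y, _, hy⟩
    exact ⟨y, hy⟩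

/-- On a bounded domain, a `Σₖ` relation agrees with a bounded relation. -/
theorem SigmaDef.exists_bddDef_below {k : ℕ} (hC : Collection M (k + 1))
    {R : (ℕ → M) → Prop} (hR : SigmaDef k R) (v : ℕ → M) (m : M) :
    ∃ Q, BddDef Q ∧ ∃ u, ∀ x < m, R (cons x v) ↔ Q (cons x u) := by
  induction k generalizing R v with
  | zero => exact ⟨R, hR, v, fun _ _ => Iff.rfl⟩
  | succ k ih =>
    have hR' := hR.not_succ
    obtain ⟨A, hA, rfl⟩ := hR
    obtain ⟨b, hb⟩ := hC _ ((bddClosed hC).or hA.not_succ.succ hR'.tail) v m fun x _ => by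
      by_cases h : ∃ y, ¬ A (cons y (cons x v))
      · exact h.imp fun y => Or.inl
      · exact ⟨0, Or.inr h⟩
    obtain ⟨Q, hQ, u, hu⟩ := exists_below_of_bound (hC.mono (by omega)) hA v m b
      fun x hx h => (hb x hx).imp fun y hy => ⟨hy.1, hy.2.resolve_right (not_not.2 h)⟩
    obtain ⟨Q', hQ', u', hu'⟩ := ih (hC.mono (by omega)) hQ u
    exact ⟨_, hQ'.not, u', fun x hx => (hu x hx).trans (not_congr (hu' x hx))⟩

theorem DeltaDef.exists_bddDef_below {k : ℕ} (hC : Collection M (k + 1))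
    {R : (ℕ → M) → Prop} (hR : DeltaDef (k + 1) R) (v : ℕ → M) (m : M) :
    ∃ Q, BddDef Q ∧ ∃ u, ∀ x < m, R (cons x v) ↔ Q (cons x u) := by
  obtain ⟨⟨A, hA, rfl⟩, B, hB, hRB⟩ := hR
  replace hRB : ∀ v, (¬ ∃ y, ¬ A (cons y v)) ↔ ∃ x, ¬ B (cons x v) :=
    fun v => iff_of_eq (congrFun hRB v)
  have h := SigmaDef.bddClosed (hC.mono k.le_succ)
  obtain ⟨b, hb⟩ := hC _ (h.and hA hB).not_succ v m fun x _ => by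
    simp only [not_and_or, exists_or, ← hRB]
    exact em _
  obtain ⟨Q, hQ, u, hu⟩ := SigmaDef.exists_below_of_bound (hC.mono k.le_succ) hA v m b
    fun x hx hR => (hb x hx).imp fun y hy => ⟨hy.1, fun hA =>
      (hRB (cons x v)).2 ⟨y, fun hB => hy.2 ⟨hA, hB⟩⟩ hR⟩
  obtain ⟨Q', hQ', u', hu'⟩ := hQ.exists_bddDef_below hC u m
  exact ⟨_, hQ'.not, u', fun x hx => (hu x hx).trans (not_congr (hu' x hx))⟩

theorem DeltaDef.induction {k : ℕ} (hI : BddInduction M) (hC : Collection M (k + 1))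
    {R : (ℕ → M) → Prop} (hR : DeltaDef (k + 1) R) (v : ℕ → M) (h0 : R (cons 0 v))
    (hs : ∀ x, R (cons x v) → R (cons (x + 1) v)) (x : M) : R (cons x v) := by
  obtain ⟨Q, hQ, u, hu⟩ := hR.exists_bddDef_below hC v (x + 1)
  have hx : ∀ y, y < x + 1 → Q (cons y u) := by
    refine hI (fun w => w 0 < w 1 + 1 → Q (cons (w 0) fun i => w (i + 2))) ?_ (cons x u) ?_ ?_
    · have hQ' : BddDef fun w : ℕ → M => Q (cons (w 0) fun i => w (i + 2)) :=
        hQ.comp (Poly.cons (.var 0) fun i => .var (i + 2))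
      simpa only [imp_iff_not_or] using
        (BddDef.lt (.var 0) ((Poly.var 1).add .one)).not.or hQ'
    · exact fun h => (hu 0 h).1 h0
    · intro y ih hy
      have hy' : y < x + 1 := (Order.lt_add_one_iff.2 le_rfl).trans hy
      exact (hu _ hy).1 (hs y ((hu y hy').2 (ih hy')))
  exact (hu x (Order.lt_add_one_iff.2 le_rfl)).2 (hx x (Order.lt_add_one_iff.2 le_rfl))

/-! ### Coding of sets by products of pairwise coprime moduli -/

/-- The number `c` codes the set of all `j` for which the `j`-th modulus `1 + (j + 1) d`
divides `c`. -/
def InCode (d c j : M) : Prop := 1 + (j + 1) * d ∣ c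

/-- Euclid's lemma holds for `p` with respect to the factor `c`. -/
def CoprimeTo (p c : M) : Prop := ∀ q, p ∣ q * c → p ∣ q

section

omit [LinearOrder M] [IsStrictOrderedRing M] [SuccAddOrder M]

theorem CoprimeTo.mul {p c c' : M} (h : CoprimeTo p c) (h' : CoprimeTo p c') :
    CoprimeTo p (c * c') :=
  fun q hq => h q (h' _ (by rwa [mul_assoc]))

theorem CoprimeTo.mul_dvd {p c r : M} (h : CoprimeTo p c) (hc : c ∣ r) (hp : p ∣ r) :
    c * p ∣ r := by
  obtain ⟨q, rfl⟩ := hc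
  exact mul_dvd_mul_left c (h q (by rwa [mul_comm]))

end

variable [CanonicallyOrderedAdd M]

section

omit [SuccAddOrder M]

theorem dvd_of_dvd_add_left {p a b : M} (h : p ∣ a + b) (ha : p ∣ a) : p ∣ b := by
  obtain ⟨k, hk⟩ := h
  obtain ⟨l, rfl⟩ := ha
  rcases le_total l k with h | h
  · obtain ⟨m, rfl⟩ := exists_add_of_le h
    exact ⟨m, add_left_cancel (hk.trans (mul_add _ _ _))⟩
  · have : p * l + b ≤ p * l + 0 := by
      rw [hk, add_zero]; exact mul_le_mul_of_nonneg_left h zero_le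
    have hb : b = 0 := le_antisymm (le_of_add_le_add_left this) zero_le
    exact hb ▸ dvd_zero p

theorem coprimeTo_modulus_self (d x : M) : CoprimeTo (1 + x * d) d := by
  intro q hq
  refine dvd_of_dvd_add_left (a := q * d * x) ?_ (hq.mul_right x)
  exact ⟨q, by ring⟩

theorem coprimeTo_modulus {d k x y : M} (hk : k ∣ d) (h : x = y + k ∨ y = x + k) :
    CoprimeTo (1 + x * d) (1 + y * d) := by
  intro q hq
  obtain ⟨e, he⟩ := hk
  have key : 1 + x * d ∣ q * k * d := by
    rcases h with h | h
    · refine dvd_of_dvd_add_left (a := q * (1 + y * d)) ?_ hq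
      exact ⟨q, by rw [h]; ring⟩
    · refine dvd_of_dvd_add_left (a := q * (1 + x * d)) ?_ (dvd_mul_left _ _)
      convert hq using 1
      rw [h]; ring
  refine coprimeTo_modulus_self d x q (coprimeTo_modulus_self d x _ ?_)
  have : q * d * d = q * k * d * e := by rw [he]; ring
  exact this ▸ key.mul_right e

theorem coprimeTo_modulus_of_ne {d s i j : M} (hd : ∀ k < s, 0 < k → k ∣ d) (hi : i < s)
    (hj : j < s) (hij : i ≠ j) : CoprimeTo (1 + (i + 1) * d) (1 + (j + 1) * d) := by
  rcases lt_or_gt_of_ne hij with h | h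
  · obtain ⟨k, rfl⟩ := exists_add_of_le h.le
    have hk : 0 < k := lt_of_add_lt_add_left (a := i) (by simpa using h)
    exact coprimeTo_modulus (hd k (lt_of_le_of_lt le_add_self hj) hk) (.inr (by ring))
  · obtain ⟨k, rfl⟩ := exists_add_of_le h.le
    have hk : 0 < k := lt_of_add_lt_add_left (a := j) (by simpa using h)
    exact coprimeTo_modulus (hd k (lt_of_le_of_lt le_add_self hi) hk) (.inl (by ring))

theorem inCode_mul_iff {d s c i j : M} (hd : ∀ k < s, 0 < k → k ∣ d) (hi : i < s)
    (hj : j < s) (hij : i ≠ j) : InCode d (c * (1 + (j + 1) * d)) i ↔ InCode d c i :=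
  ⟨coprimeTo_modulus_of_ne hd hi hj hij c, fun h => h.mul_right _⟩

end

theorem not_inCode_one {d j : M} (hd : 0 < d) : ¬ InCode d 1 j := by
  rintro ⟨q, hq⟩
  have hq0 : 0 < q := pos_of_ne_zero fun h => by simp [h] at hq
  have h1 : (1 : M) ≤ q := by simpa using Order.add_one_le_of_lt hq0
  have h2 : 0 < (j + 1) * d := mul_pos (lt_of_lt_of_le one_pos le_add_self) hd
  have h3 : (1 + (j + 1) * d) * 1 ≤ (1 + (j + 1) * d) * q :=
    mul_le_mul_of_nonneg_left h1 zero_le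
  rw [← hq, mul_one] at h3
  exact absurd h3 (not_le.2 (by simpa using h2))

theorem dvd_iff_exists_lt {p c : M} (hp : 0 < p) : p ∣ c ↔ ∃ q, q < c + 1 ∧ c = p * q := by
  refine ⟨fun ⟨q, h⟩ => ⟨q, Order.lt_add_one_iff.2 ?_, h⟩, fun ⟨q, _, h⟩ => ⟨q, h⟩⟩
  have h1 : (1 : M) ≤ p := by simpa using Order.add_one_le_of_lt hp
  simpa [h] using mul_le_mul_of_nonneg_right h1 (zero_le (a := q))

omit [SuccAddOrder M] in
theorem modulus_pos (d j : M) : 0 < 1 + (j + 1) * d := lt_of_lt_of_le one_pos le_self_add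

theorem remainder_lt {a b q y z : M} (hbq : b < q) (hy : y < a) : a * b + y < a * q + z :=
  calc a * b + y < a * b + a := by gcongr
    _ = a * (b + 1) := by ring
    _ ≤ a * q := mul_le_mul_of_nonneg_left (Order.add_one_le_of_lt hbq) zero_le
    _ ≤ a * q + z := le_self_add

omit [LinearOrder M] [IsStrictOrderedRing M] [SuccAddOrder M] [CanonicallyOrderedAdd M] in
theorem Poly.modulus {D J : (ℕ → M) → M} (hD : Poly D) (hJ : Poly J) :
    Poly fun v => 1 + (J v + 1) * D v :=
  Poly.one.add ((hJ.add .one).mul hD)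

omit [IsStrictOrderedRing M] [SuccAddOrder M] [CanonicallyOrderedAdd M] in
theorem BddDef.dvd {f g : (ℕ → M) → M} (hf : Poly f) (hg : Poly g) :
    BddDef fun v => ∃ q, q < g v + 1 ∧ g v = f v * q :=
  BddDef.bddClosed.bex (P := fun q v => g v = f v * q) (hg.add .one)
    (.eq hg.tail (hf.tail.mul (.var 0)))

theorem BddDef.inCode {D C J : (ℕ → M) → M} (hD : Poly D) (hC : Poly C) (hJ : Poly J) :
    BddDef fun v => InCode (D v) (C v) (J v) := by
  simpa only [InCode, dvd_iff_exists_lt (modulus_pos _ _)] using BddDef.dvd (hD.modulus hJ) hC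

theorem DeltaDef.coprimeTo {k : ℕ} (hk : Collection M 0) {D C J : (ℕ → M) → M} (hD : Poly D)
    (hC : Poly C) (hJ : Poly J) :
    DeltaDef (k + 2) fun v => CoprimeTo (1 + (J v + 1) * D v) (C v) := by
  have h : SigmaDef 1 fun v => ¬ CoprimeTo (1 + (J v + 1) * D v) (C v) := by
    simp only [CoprimeTo, dvd_iff_exists_lt (modulus_pos _ _), not_forall, exists_prop]
    refine SigmaDef.ex hk (P := fun q v =>
      (∃ r, r < q * C v + 1 ∧ q * C v = (1 + (J v + 1) * D v) * r) ∧
        ¬ ∃ r, r < q + 1 ∧ q = (1 + (J v + 1) * D v) * r) (SigmaDef.succ ?_)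
    exact (BddDef.dvd (hD.modulus hJ).tail ((Poly.var 0).mul hC.tail)).and
      (BddDef.dvd (hD.modulus hJ).tail (.var 0)).not
  simpa only [not_not] using (h.mono (Nat.le_add_left 1 k)).delta.not

/-- There are arbitrarily long sequences of pairwise coprime moduli. -/
theorem exists_common_multiple (hI : BddInduction M) (hC : Collection M 2) (s : M) :
    ∃ d, 0 < d ∧ ∀ k < s, 0 < k → k ∣ d := by
  have hB : SigmaDef (M := M) 1 fun w =>
      ∃ d, 0 < d ∧ ∀ k, k < w 0 → (¬ 0 < k ∨ ∃ q, q < d + 1 ∧ d = k * q) := by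
    refine SigmaDef.ex (hC.mono (by omega))
      (P := fun d w => 0 < d ∧ ∀ k, k < w 0 → (¬ 0 < k ∨ ∃ q, q < d + 1 ∧ d = k * q))
      (SigmaDef.succ ?_)
    exact (BddDef.lt .zero (.var 0)).and (BddDef.bddClosed.ball (.var 1)
      ((BddDef.lt .zero (.var 0)).not.or (BddDef.dvd (.var 0) (.var 1))))
  obtain ⟨d, hd, h⟩ := hB.delta.induction hI hC (fun _ => 0)
    ⟨1, one_pos, fun k hk => absurd hk (not_lt.2 zero_le)⟩ (by
      rintro x ⟨d, hd, h⟩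
      rcases eq_or_ne x 0 with rfl | hx
      · refine ⟨1, one_pos, fun k hk => Or.inl ?_⟩
        have hk : k < 0 + 1 := hk
        exact not_lt.2 (Order.lt_add_one_iff.1 hk)
      have hx : 0 < x := pos_of_ne_zero hx
      refine ⟨d * x, mul_pos hd hx, fun k hk => ?_⟩
      rcases eq_zero_or_pos k with rfl | hk0
      · exact Or.inl (lt_irrefl 0)
      refine Or.inr ((dvd_iff_exists_lt hk0).1 ?_)
      rcases (Order.lt_add_one_iff.1 hk).lt_or_eq with hk | hk
      · exact ((dvd_iff_exists_lt hk0).2 ((h k hk).resolve_left (not_not.2 hk0))).mul_right x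
      · have hk : k = x := hk
        exact hk ▸ dvd_mul_left k d) s
  exact ⟨d, hd, fun k hk hk0 =>
    (dvd_iff_exists_lt hk0).2 ((h k hk).resolve_left (not_not.2 hk0))⟩

theorem exists_forall_inCode (hI : BddInduction M) (hC : Collection M 2) (d s : M) :
    ∃ p, 0 < p ∧ ∀ i < s, InCode d p i := by
  have hB : SigmaDef (M := M) 1 fun w => ∃ p, 0 < p ∧ ∀ i, i < w 0 → InCode (w 1) p i := by
    refine SigmaDef.ex (hC.mono (by omega))
      (P := fun p w => 0 < p ∧ ∀ i, i < w 0 → InCode (w 1) p i) (SigmaDef.succ ?_)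
    exact (BddDef.lt .zero (.var 0)).and (BddDef.bddClosed.ball
      (P := fun i w => InCode (w 2) (w 0) i) (.var 1) (.inCode (.var 3) (.var 1) (.var 0)))
  refine hB.delta.induction hI hC (fun _ => d)
    ⟨1, one_pos, fun k hk => absurd hk (not_lt.2 zero_le)⟩ ?_ s
  rintro x ⟨p, hp, h⟩
  refine ⟨p * (1 + (x + 1) * d), mul_pos hp (modulus_pos d x), fun i hi => ?_⟩
  rcases (Order.lt_add_one_iff.1 hi).lt_or_eq with hi | hi
  · exact (h i hi).mul_right _
  · have hi : i = x := hi
    exact hi ▸ dvd_mul_left _ p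

/-! ### The weak regularity principle -/

/-- `j` leaves the remainder `y` modulo `a`. -/
def Hits (a j y : M) : Prop := ∃ q, q < j + 1 ∧ j = a * q + y

/-- For each `x` some `y < a` in the relation `F` to `x` is not forbidden, where every `j < x`
below `s` which is coded by `c`, or which is the predecessor of `e`, forbids its remainder
modulo `a`. -/
def Viable (F : (ℕ → M) → Prop) (v : ℕ → M) (a d c s e : M) : Prop :=
  ∀ x, ∃ y, y < a ∧ F (cons y (cons x v)) ∧
    ∀ j, j < s → j < x → (j + 1 = e ∨ InCode d c j) → ¬ Hits a j y

/-- Below `s`, the code `c` consists of the `i` which can be added to its elements below `i`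
while staying viable. -/
def GreedyCode (F : (ℕ → M) → Prop) (v : ℕ → M) (a d c s : M) : Prop :=
  ∀ i, i < s → (InCode d c i ↔ Viable F v a d c (i + 1) (i + 1))

omit [CanonicallyOrderedAdd M] in
theorem Viable.congr {F : (ℕ → M) → Prop} {v : ℕ → M} {a d c d' c' i : M}
    (h : ∀ j < i, InCode d c j ↔ InCode d' c' j) (hV : Viable F v a d c (i + 1) (i + 1)) :
    Viable F v a d' c' (i + 1) (i + 1) := by
  intro x
  obtain ⟨y, hy, hF, hj⟩ := hV x
  refine ⟨y, hy, hF, fun j hji hjx hjc => hj j hji hjx ?_⟩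
  rcases (Order.lt_add_one_iff.1 hji).lt_or_eq with hji | rfl
  · exact hjc.imp_right (h j hji).2
  · exact Or.inl rfl

omit [CanonicallyOrderedAdd M] in
theorem viable_congr {F : (ℕ → M) → Prop} {v : ℕ → M} {a d c d' c' i : M}
    (h : ∀ j < i, InCode d c j ↔ InCode d' c' j) :
    Viable F v a d c (i + 1) (i + 1) ↔ Viable F v a d' c' (i + 1) (i + 1) :=
  ⟨.congr h, .congr fun j hj => (h j hj).symm⟩

section Definability

variable {k : ℕ} {F : (ℕ → M) → Prop} {σ : (ℕ → M) → ℕ → M} {A D C T E J Y : (ℕ → M) → M}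

omit [IsStrictOrderedRing M] [SuccAddOrder M] [CanonicallyOrderedAdd M] in
theorem BddDef.hits (hA : Poly A) (hJ : Poly J) (hY : Poly Y) :
    BddDef fun v => Hits (A v) (J v) (Y v) :=
  BddDef.bddClosed.bex (P := fun q v => J v = A v * q + Y v) (hJ.add .one)
    (.eq hJ.tail ((hA.tail.mul (.var 0)).add hY.tail))

theorem DeltaDef.viable (hk : Collection M (k + 1)) (hF : SigmaDef (k + 1) fun v => ¬ F v)
    (hσ : ∀ i, Poly fun v => σ v i) (hA : Poly A) (hD : Poly D) (hC : Poly C) (hT : Poly T)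
    (hE : Poly E) :
    DeltaDef (k + 2) fun v => Viable F (σ v) (A v) (D v) (C v) (T v) (E v) := by
  have hcl := SigmaDef.bddClosed hk
  have h : SigmaDef (k + 1) fun v => ∃ x, ∀ y, y < A v → (¬ F (cons y (cons x (σ v))) ∨
      ∃ j, j < T v ∧ (j < x ∧ (j + 1 = E v ∨ InCode (D v) (C v) j) ∧ Hits (A v) j y)) := by
    refine SigmaDef.ex (hk.mono k.le_succ) (P := fun x v => ∀ y, y < A v →
      (¬ F (cons y (cons x (σ v))) ∨ ∃ j, j < T v ∧
        (j < x ∧ (j + 1 = E v ∨ InCode (D v) (C v) j) ∧ Hits (A v) j y))) ?_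
    refine hcl.ball hA.tail (P := fun y w => ¬ F (cons y (cons (w 0) (σ fun i => w (i + 1)))) ∨
      ∃ j, j < T (fun i => w (i + 1)) ∧ (j < w 0 ∧ (j + 1 = E (fun i => w (i + 1)) ∨
        InCode (D fun i => w (i + 1)) (C fun i => w (i + 1)) j) ∧
          Hits (A fun i => w (i + 1)) j y)) (hcl.or ?_ ?_)
    · exact hF.comp (Poly.cons (.var 0) (Poly.cons (.var 1) fun i => (hσ i).tail.tail))
    · refine SigmaDef.mono (k := 0) (BddDef.bex (R := fun w => w 0 < w 2 ∧
        (w 0 + 1 = E (fun i => w (i + 3)) ∨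
          InCode (D fun i => w (i + 3)) (C fun i => w (i + 3)) (w 0)) ∧
          Hits (A fun i => w (i + 3)) (w 0) (w 1)) hT.tail.tail ?_) (Nat.zero_le _)
      exact (BddDef.lt (.var 0) (.var 2)).and
        (((BddDef.eq ((Poly.var 0).add .one) hE.tail.tail.tail).or
          (.inCode hD.tail.tail.tail hC.tail.tail.tail (.var 0))).and
          (.hits hA.tail.tail.tail (.var 0) (.var 1)))
  convert h.delta.not using 2 with v
  simp only [Viable]
  push Not
  rfl

theorem DeltaDef.greedyCode (hk : Collection M (k + 2)) (hF : SigmaDef (k + 1) fun v => ¬ F v)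
    (hσ : ∀ i, Poly fun v => σ v i) (hA : Poly A) (hD : Poly D) (hC : Poly C) (hT : Poly T) :
    DeltaDef (k + 2) fun v => GreedyCode F (σ v) (A v) (D v) (C v) (T v) := by
  refine (DeltaDef.bddClosed hk).ball (P := fun i v => InCode (D v) (C v) i ↔
    Viable F (σ v) (A v) (D v) (C v) (i + 1) (i + 1)) hT (DeltaDef.iff hk ?_ ?_)
  · exact (BddDef.inCode hD.tail hC.tail (.var 0)).delta _
  · exact DeltaDef.viable (hk.mono (k + 1).le_succ) hF (fun i => (hσ i).tail) hA.tail hD.tail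
      hC.tail ((Poly.var 0).add .one) ((Poly.var 0).add .one)

end Definability

section Regularity

variable {k : ℕ} {F : (ℕ → M) → Prop}

theorem GreedyCode.viable (hI : BddInduction M) (hk : Collection M (k + 2))
    (hF : SigmaDef (k + 1) fun v => ¬ F v) {v : ℕ → M} {a d c s : M}
    (hc : GreedyCode F v a d c s) (h0 : ∀ x, ∃ y < a, F (cons y (cons x v))) :
    Viable F v a d c s 0 := by
  have hR : DeltaDef (k + 2) fun w : ℕ → M => w 0 < w 1 + 1 →
      Viable F (fun i => w (i + 5)) (w 2) (w 3) (w 4) (w 0) 0 :=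
    ((BddDef.lt (.var 0) ((Poly.var 1).add .one)).delta _).imp hk
      (DeltaDef.viable (hk.mono (k + 1).le_succ) hF (fun i => .var (i + 5)) (.var 2) (.var 3)
        (.var 4) (.var 0) .zero)
  refine hR.induction hI hk (cons s (cons a (cons d (cons c v)))) ?_ ?_ s
    (Order.lt_add_one_iff.2 le_rfl)
  · intro _ x
    obtain ⟨y, hy, h⟩ := h0 x
    exact ⟨y, hy, h, fun j hj => absurd hj (not_lt.2 zero_le)⟩
  · intro i ih hi
    have hi : i + 1 < s + 1 := hi
    have his : i < s := lt_of_add_lt_add_right hi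
    have hV : Viable F v a d c i 0 := ih (Order.lt_add_one_iff.2 his.le)
    change Viable F v a d c (i + 1) 0
    by_cases hic : InCode d c i
    · intro x
      obtain ⟨y, hy, hFy, h⟩ := (hc i his).1 hic x
      exact ⟨y, hy, hFy, fun j hj hjx hjc => h j hj hjx
        (Or.inr (hjc.resolve_left (add_pos_of_nonneg_of_pos zero_le one_pos).ne'))⟩
    · intro x
      obtain ⟨y, hy, hFy, h⟩ := hV x
      refine ⟨y, hy, hFy, fun j hj hjx hjc => ?_⟩
      rcases (Order.lt_add_one_iff.1 hj).lt_or_eq with hj | rfl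
      · exact h j hj hjx hjc
      · exact absurd (hjc.resolve_left (add_pos_of_nonneg_of_pos zero_le one_pos).ne') hic

theorem exists_greedyCode (hI : BddInduction M) (hk : Collection M (k + 2))
    (hF : SigmaDef (k + 1) fun v => ¬ F v) (v : ℕ → M) (a s : M) :
    ∃ d c, GreedyCode F v a d c s := by
  obtain ⟨d, hd0, hd⟩ := exists_common_multiple hI (hk.mono (by omega)) s
  obtain ⟨p, hp0, hp⟩ := exists_forall_inCode hI (hk.mono (by omega)) d s
  have hcl := DeltaDef.bddClosed hk
  have hR : DeltaDef (k + 2) fun w : ℕ → M => w 0 < w 1 + 1 → ∃ c, c < w 2 + 1 ∧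
      ((∃ q, q < w 2 + 1 ∧ w 2 = c * q) ∧
        (∀ i, i < w 1 → (InCode (w 3) c i ∨ CoprimeTo (1 + (i + 1) * w 3) c)) ∧
        (∀ i, i < w 1 → (i < w 0 ∨ ¬ InCode (w 3) c i)) ∧
        GreedyCode F (fun i => w (i + 5)) (w 4) (w 3) c (w 0)) := by
    refine ((BddDef.lt (.var 0) ((Poly.var 1).add .one)).delta _).imp hk
      (hcl.bex (P := fun c w => (∃ q, q < w 2 + 1 ∧ w 2 = c * q) ∧
        (∀ i, i < w 1 → (InCode (w 3) c i ∨ CoprimeTo (1 + (i + 1) * w 3) c)) ∧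
        (∀ i, i < w 1 → (i < w 0 ∨ ¬ InCode (w 3) c i)) ∧
        GreedyCode F (fun i => w (i + 5)) (w 4) (w 3) c (w 0)) ((Poly.var 2).add .one)
      (hcl.and ((BddDef.dvd (.var 0) (.var 3)).delta _) (hcl.and ?_ (hcl.and ?_ ?_))))
    · exact hcl.ball (P := fun i w => InCode (w 4) (w 0) i ∨
        CoprimeTo (1 + (i + 1) * w 4) (w 0)) (.var 2)
        (hcl.or ((BddDef.inCode (.var 5) (.var 1) (.var 0)).delta _)
          (DeltaDef.coprimeTo (hk.mono (by omega)) (.var 5) (.var 1) (.var 0)))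
    · exact hcl.ball (P := fun i w => i < w 1 ∨ ¬ InCode (w 4) (w 0) i) (.var 2)
        (((BddDef.lt (.var 0) (.var 2)).or
          (BddDef.inCode (.var 5) (.var 1) (.var 0)).not).delta _)
    · exact DeltaDef.greedyCode hk hF (fun i => .var (i + 6)) (.var 5) (.var 4) (.var 0) (.var 1)
  have hdvd : ∀ {c}, (∃ q, q < p + 1 ∧ p = c * q) ↔ c ∣ p := fun {c} =>
    ⟨fun ⟨q, _, h⟩ => ⟨q, h⟩, fun h => (dvd_iff_exists_lt (pos_of_ne_zero fun h0 =>
      hp0.ne' (zero_dvd_iff.1 (h0 ▸ h)))).1 h⟩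
  have hle : ∀ {c}, c ∣ p → c < p + 1 := fun {c} ⟨q, hq⟩ => by
    have hq0 : 0 < q := pos_of_ne_zero fun h => by simp [h] at hq; exact hp0.ne' hq
    have h1 : (1 : M) ≤ q := by simpa using Order.add_one_le_of_lt hq0
    refine Order.lt_add_one_iff.2 ?_
    simpa [hq] using mul_le_mul_of_nonneg_left h1 (zero_le (a := c))
  obtain ⟨c, _, _, _, _, hc⟩ := hR.induction hI hk (cons s (cons p (cons d (cons a v))))
    (fun _ => ⟨1, hle (one_dvd p), hdvd.2 (one_dvd p),
      fun i _ => Or.inr fun q hq => by rwa [mul_one] at hq,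
      fun i _ => Or.inr (not_inCode_one hd0),
      fun i hi => absurd hi (not_lt.2 zero_le)⟩) (by
    intro t ih ht
    have ht : t + 1 < s + 1 := ht
    have hts : t < s := lt_of_add_lt_add_right ht
    obtain ⟨c, hcp, hcd, hcop, hnot, hcode⟩ := ih (Order.lt_add_one_iff.2 hts.le)
    replace hcd : c ∣ p := hdvd.1 hcd
    replace hcop : ∀ i < s, InCode d c i ∨ CoprimeTo (1 + (i + 1) * d) c := hcop
    replace hnot : ∀ i < s, i < t ∨ ¬ InCode d c i := hnot
    replace hcode : GreedyCode F v a d c t := hcode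
    have hct : ¬ InCode d c t := (hnot t hts).resolve_left (lt_irrefl t)
    by_cases hV : Viable F v a d c (t + 1) (t + 1)
    · have hdiv : c * (1 + (t + 1) * d) ∣ p :=
        ((hcop t hts).resolve_left hct).mul_dvd hcd (hp t hts)
      refine ⟨c * (1 + (t + 1) * d), hle hdiv, hdvd.2 hdiv, fun i hi => ?_, fun i hi => ?_,
        fun i hi => ?_⟩
      · rcases eq_or_ne i t with rfl | hit
        · exact Or.inl (dvd_mul_left _ c)
        · exact (hcop i hi).imp (fun h => h.mul_right _)
            fun h => h.mul (coprimeTo_modulus_of_ne hd hi hts hit)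
      · have hi : i < s := hi
        rcases lt_or_ge i (t + 1) with h | h
        · exact Or.inl h
        · have hti : t < i := (Order.lt_add_one_iff.2 le_rfl).trans_le h
          refine Or.inr fun h' => ?_
          have h' := (inCode_mul_iff hd hi hts hti.ne').1 h'
          exact (hnot i hi).elim (fun h => lt_asymm h hti) fun h => h h'
      · have hi : i < t + 1 := hi
        have hag : ∀ j < i, InCode d (c * (1 + (t + 1) * d)) j ↔ InCode d c j := fun j hj =>
          have hjt := hj.trans_le (Order.lt_add_one_iff.1 hi)
          inCode_mul_iff hd (hjt.trans hts) hts hjt.ne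
        refine Iff.trans ?_ (viable_congr hag).symm
        rcases (Order.lt_add_one_iff.1 hi).lt_or_eq with hi | rfl
        · exact (inCode_mul_iff hd (hi.trans hts) hts hi.ne).trans (hcode i hi)
        · exact iff_of_true (dvd_mul_left _ c) hV
    · refine ⟨c, hcp, hdvd.2 hcd, hcop, fun i hi => (hnot i hi).imp_left fun h =>
        h.trans (Order.lt_add_one_iff.2 le_rfl), fun i hi => ?_⟩
      have hi : i < t + 1 := hi
      rcases (Order.lt_add_one_iff.1 hi).lt_or_eq with hi | rfl
      · exact hcode i hi
      · exact iff_of_false hct hV) s (Order.lt_add_one_iff.2 le_rfl)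
  exact ⟨d, c, hc⟩

/-- Greedy codes are unique. -/
theorem GreedyCode.inCode_iff (hI : BddInduction M) {v : ℕ → M} {a d c s d' c' s' : M}
    (h : GreedyCode F v a d c s) (h' : GreedyCode F v a d' c' s') {i : M} (hi : i < s)
    (hi' : i < s') : InCode d c i ↔ InCode d' c' i := by
  have hB : BddDef fun w : ℕ → M => ∀ j, j < w 0 →
      (¬ (j < w 1 ∧ j < w 2) ∨ ¬ (InCode (w 3) (w 4) j ∧ ¬ InCode (w 5) (w 6) j) ∧
        ¬ (InCode (w 5) (w 6) j ∧ ¬ InCode (w 3) (w 4) j)) := by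
    refine BddDef.bddClosed.ball (P := fun j w => ¬ (j < w 1 ∧ j < w 2) ∨
      ¬ (InCode (w 3) (w 4) j ∧ ¬ InCode (w 5) (w 6) j) ∧
        ¬ (InCode (w 5) (w 6) j ∧ ¬ InCode (w 3) (w 4) j)) (.var 0) ?_
    have h₁ := BddDef.inCode (M := M) (.var 4) (.var 5) (.var 0)
    have h₂ := BddDef.inCode (M := M) (.var 6) (.var 7) (.var 0)
    exact ((BddDef.lt (.var 0) (.var 2)).and (BddDef.lt (.var 0) (.var 3))).not.or
      ((h₁.and h₂.not).not.and (h₂.and h₁.not).not)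
  have key : ∀ x, ∀ j < x, j < s → j < s' → (InCode d c j ↔ InCode d' c' j) := by
    intro x
    have := hI _ hB (cons s (cons s' (cons d (cons c (cons d' (cons c' fun _ => 0))))))
      (fun j hj => absurd hj (not_lt.2 zero_le)) (by
        intro x ih j hj
        have hj : j < x + 1 := hj
        change ¬ (j < s ∧ j < s') ∨ ¬ (InCode d c j ∧ ¬ InCode d' c' j) ∧
          ¬ (InCode d' c' j ∧ ¬ InCode d c j)
        replace ih : ∀ j < x, ¬ (j < s ∧ j < s') ∨ ¬ (InCode d c j ∧ ¬ InCode d' c' j) ∧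
          ¬ (InCode d' c' j ∧ ¬ InCode d c j) := ih
        refine or_iff_not_imp_left.2 fun hjs => ?_
        obtain ⟨hjs, hjs'⟩ := not_not.1 hjs
        have := (h j hjs).trans ((viable_congr (d' := d') (c' := c') fun l hl => ?_).trans
          (h' j hjs').symm)
        · tauto
        · have := ih l (hl.trans_le (Order.lt_add_one_iff.1 hj))
          have := hl.trans hjs
          have := hl.trans hjs'
          tauto) x
    replace this : ∀ j < x, ¬ (j < s ∧ j < s') ∨ ¬ (InCode d c j ∧ ¬ InCode d' c' j) ∧
      ¬ (InCode d' c' j ∧ ¬ InCode d c j) := this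
    intro j hj hjs hjs'
    have := this j hj
    tauto
  exact key (i + 1) i (Order.lt_add_one_iff.2 le_rfl) hi hi'

/-- If `y` is unrelated to all large `x`, then some `i` with remainder `y` is in the greedy code. -/
theorem exists_hits_inCode (hI : BddInduction M) (hk : Collection M (k + 2))
    (hF : SigmaDef (k + 1) fun v => ¬ F v) {v : ℕ → M} {a b y : M}
    (h0 : ∀ x, ∃ y < a, F (cons y (cons x v))) (hy : y < a)
    (hb : ∀ x, b < x → ¬ F (cons y (cons x v))) :
    ∃ i, Hits a i y ∧ ∃ d c, GreedyCode F v a d c (i + 1) ∧ InCode d c i := by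
  have ha : (1 : M) ≤ a := by simpa using Order.add_one_le_of_lt (lt_of_le_of_lt zero_le hy)
  have hb' : b ≤ a * b + y :=
    le_add_of_le_of_nonneg (by simpa using mul_le_mul_of_nonneg_right ha (zero_le (a := b)))
      zero_le
  obtain ⟨d, c, hc⟩ := exists_greedyCode hI hk hF v a (a * b + y + 1)
  refine ⟨a * b + y, ⟨b, Order.lt_add_one_iff.2 hb', rfl⟩, d, c, hc,
    (hc _ (Order.lt_add_one_iff.2 le_rfl)).2 fun x => ?_⟩
  have hc' : GreedyCode F v a d c (a * b + y) := fun i hi =>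
    hc i (hi.trans (Order.lt_add_one_iff.2 le_rfl))
  obtain ⟨z, hz, hFz, h⟩ := hc'.viable hI hk hF h0 x
  refine ⟨z, hz, hFz, fun j hj hjx hjc hit => ?_⟩
  rcases (Order.lt_add_one_iff.1 hj).lt_or_eq with hj | rfl
  · refine h j hj hjx (Or.inr (hjc.resolve_left fun h => ?_)) hit
    exact hj.ne (add_right_cancel h)
  · obtain ⟨q, _, hq⟩ := hit
    have hbq : b = q := by
      rcases lt_trichotomy b q with hlt | heq | hlt
      · exact absurd hq (remainder_lt hlt hy).ne
      · exact heq
      · exact absurd hq.symm (remainder_lt hlt hz).ne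
    subst hbq
    have hyz : y = z := add_left_cancel hq
    exact hb x (lt_of_le_of_lt hb' hjx) (hyz ▸ hFz)

/-- The weak regularity principle for `Πₖ₊₁` relations. -/
theorem weak_regularity (hI : BddInduction M) (hk : Collection M (k + 2))
    (hF : SigmaDef (k + 1) fun v => ¬ F v) (v : ℕ → M) (a : M)
    (h0 : ∀ x, ∃ y < a, F (cons y (cons x v))) :
    ∃ y < a, ∀ b, ∃ x, b < x ∧ F (cons y (cons x v)) := by
  by_contra! hcon
  have hcl := SigmaDef.bddClosed hk
  have hR : SigmaDef (k + 2) fun w : ℕ → M => Hits (w 2) (w 0) (w 1) ∧ ∃ d c,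
      GreedyCode F (fun i => w (i + 3)) (w 2) d c (w 0 + 1) ∧ InCode d c (w 0) := by
    refine hcl.and ((BddDef.hits (.var 2) (.var 0) (.var 1)).delta _).1 ?_
    have hk' := hk.mono (k + 1).le_succ
    refine SigmaDef.ex hk' (P := fun d w => ∃ c,
      GreedyCode F (fun i => w (i + 3)) (w 2) d c (w 0 + 1) ∧ InCode d c (w 0)) ?_
    refine SigmaDef.ex hk' (P := fun c w =>
      GreedyCode F (fun i => w (i + 4)) (w 3) (w 0) c (w 1 + 1) ∧ InCode (w 0) c (w 1)) ?_
    exact hcl.and (DeltaDef.greedyCode hk hF (fun i => .var (i + 5)) (.var 4) (.var 1) (.var 0)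
      ((Poly.var 2).add .one)).1 ((BddDef.inCode (.var 1) (.var 0) (.var 2)).delta _).1
  obtain ⟨s, hs⟩ := hk _ hR (cons a v) a fun y hy => by
    obtain ⟨b, hb⟩ := hcon y hy
    exact exists_hits_inCode hI hk hF h0 hy hb
  obtain ⟨d, c, hc⟩ := exists_greedyCode hI hk hF v a s
  obtain ⟨y, hy, _, h⟩ := hc.viable hI hk hF h0 s
  obtain ⟨i, his, hit, d', c', hc', hic⟩ := hs y hy
  exact h i his his (Or.inr ((hc'.inCode_iff hI hc (Order.lt_add_one_iff.2 le_rfl) his).1 hic)) hit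

end Regularity

end Hierarchy

/-! ### Valuations -/

theorem upd_comp {α : Type} (v : ℕ → α) (ρ : ℕ → ℕ) (x : ℕ) (a : α) :
    upd (v ∘ ρ) x a = cons a v ∘ upd (fun i => ρ i + 1) x 0 := by
  funext i
  by_cases h : i = x <;> simp [upd, cons, h]

theorem upd_comp_cons {σ : ℕ → ℕ} {x : ℕ} (hx : x ∉ Set.range σ) {α : Type} (v : ℕ → α) (a : α) :
    upd v x a ∘ cons x σ = cons a (v ∘ σ) := by
  funext i
  cases i with
  | zero => exact if_pos rfl
  | succ i => exact if_neg fun h => hx ⟨i, h⟩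

theorem exists_comp_double {α : Type} (v : ℕ → α) : ∃ v', (v' ∘ fun i => 2 * i) = v :=
  ⟨fun i => v (i / 2), funext fun i => congrArg v (Nat.mul_div_cancel_left i two_pos)⟩

theorem infinite_compl_range_cons {σ : ℕ → ℕ} (hσ : (Set.range σ)ᶜ.Infinite) (x : ℕ) :
    (Set.range (cons x σ))ᶜ.Infinite := by
  refine (hσ.sdiff (Set.finite_singleton x)).mono ?_
  rintro i ⟨hi, hx⟩ ⟨j, rfl⟩
  cases j with
  | zero => exact hx rfl
  | succ j => exact hi ⟨j, rfl⟩

theorem infinite_compl_range_double : (Set.range fun i => 2 * i)ᶜ.Infinite := by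
  refine Set.infinite_of_injective_forall_mem (f := fun i : ℕ => 2 * i + 1)
    (fun i j h => by simpa using h) ?_
  rintro i ⟨j, h⟩
  simp only at h
  omega

/-! ## Models of `PA⁻` as ordered semirings -/

section Model

variable {S : Str}

instance : Zero S.M := ⟨S.zero⟩

instance : One S.M := ⟨S.one⟩

instance : Add S.M := ⟨S.add⟩

instance : Mul S.M := ⟨S.mul⟩

variable [hS : Fact (PAminus S)]

instance : CommSemiring S.M where
  add_assoc := hS.out.add_assoc
  add_comm := hS.out.add_comm
  mul_assoc := hS.out.mul_assoc
  mul_comm := hS.out.mul_comm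
  left_distrib := hS.out.distrib
  right_distrib a b c := by
    change S.mul (S.add a b) c = S.add (S.mul a c) (S.mul b c)
    rw [hS.out.mul_comm, hS.out.distrib, hS.out.mul_comm c a, hS.out.mul_comm c b]
  add_zero := hS.out.add_zero
  zero_add a := (hS.out.add_comm _ _).trans (hS.out.add_zero a)
  mul_zero := hS.out.mul_zero
  zero_mul a := (hS.out.mul_comm _ _).trans (hS.out.mul_zero a)
  mul_one := hS.out.mul_one
  one_mul a := (hS.out.mul_comm _ _).trans (hS.out.mul_one a)
  nsmul := nsmulRec
  npow := npowRec

noncomputable instance : LinearOrder S.M where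
  le a b := a = b ∨ S.lt a b
  lt := S.lt
  le_refl _ := Or.inl rfl
  le_trans a b c := by
    rintro (rfl | h) (rfl | h')
    exacts [Or.inl rfl, Or.inr h', Or.inr h, Or.inr (hS.out.lt_trans _ _ _ h h')]
  lt_iff_le_not_ge a b := by
    refine ⟨fun h => ⟨Or.inr h, ?_⟩, ?_⟩
    · rintro (rfl | h')
      exacts [hS.out.lt_irrefl _ h, hS.out.lt_irrefl _ (hS.out.lt_trans _ _ _ h h')]
    · rintro ⟨rfl | h, h'⟩
      exacts [(h' (Or.inl rfl)).elim, h]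
  le_antisymm a b := by
    rintro (h | h) (h' | h')
    exacts [h, h, h'.symm, (hS.out.lt_irrefl _ (hS.out.lt_trans _ _ _ h h')).elim]
  le_total a b := by
    rcases hS.out.lt_total a b with h | h | h
    exacts [Or.inl (Or.inr h), Or.inl (Or.inl h), Or.inr (Or.inr h)]
  toDecidableLE := Classical.decRel _

instance : IsStrictOrderedRing S.M :=
  have add_lt (a b c : S.M) (h : a < b) : c + a < c + b := by
    rw [add_comm c, add_comm c]
    exact hS.out.add_lt_add a b c h
  have zero_lt : (0 : S.M) < 1 := hS.out.zero_lt_one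
  have mul_lt (a b c : S.M) (hc : 0 < c) (h : a < b) : a * c < b * c :=
    hS.out.mul_lt_mul a b c h hc
  { add_le_add_left := fun a b h c => by
      rcases h.eq_or_lt with rfl | h
      · exact le_rfl
      · exact le_of_lt (α := S.M) (hS.out.add_lt_add a b c h)
    le_of_add_le_add_left := fun a b c h => by
      by_contra! h'
      exact (add_lt _ _ a h').not_ge h
    zero_le_one := zero_lt.le
    exists_pair_ne := ⟨0, 1, zero_lt.ne⟩
    mul_lt_mul_of_pos_left := fun c hc a b h => by
      rw [mul_comm c, mul_comm c]; exact mul_lt a b c hc h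
    mul_lt_mul_of_pos_right := fun c hc a b h => mul_lt a b c hc h }

instance : CanonicallyOrderedAdd S.M where
  exists_add_of_le {a b} h := by
    rcases h.eq_or_lt with rfl | h
    · exact ⟨0, (add_zero a).symm⟩
    · obtain ⟨c, hc⟩ := hS.out.sub a b h
      exact ⟨c, hc.symm⟩
  le_add_self _ b := by
    have hb : 0 ≤ b := (hS.out.zero_le b).elim (fun h => h.symm.le) fun h => le_of_lt h
    exact le_add_of_nonneg_left hb
  le_self_add _ b := by
    have hb : 0 ≤ b := (hS.out.zero_le b).elim (fun h => h.symm.le) fun h => le_of_lt h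
    exact le_add_of_nonneg_right hb

instance : SuccAddOrder S.M where
  succ a := a + 1
  le_succ _ := le_self_add
  max_of_succ_le h := absurd h (lt_add_one _).not_ge
  succ_le_of_lt {a b} h := (hS.out.discrete a b h : a + 1 = b ∨ a + 1 < b).elim
    (fun h => h.le) fun h => le_of_lt h
  succ_eq_add_one _ := rfl

/-! ### The relations defined by formulas -/

theorem poly_tval (t : Term) (ρ : ℕ → ℕ) : Poly fun v : ℕ → S.M => tval S (v ∘ ρ) t := by
  induction t with
  | var i => exact .var (ρ i)
  | zero => exact .zero
  | one => exact .one
  | add _ _ ih₁ ih₂ => exact .add ih₁ ih₂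
  | mul _ _ ih₁ ih₂ => exact .mul ih₁ ih₂

theorem Delta0.bddDef {φ : Fml} (hφ : Delta0 φ) (ρ : ℕ → ℕ) :
    BddDef fun v : ℕ → S.M => Sat0 S (v ∘ ρ) φ := by
  induction hφ generalizing ρ with
  | eq t u => exact .eq (poly_tval t ρ) (poly_tval u ρ)
  | lt t u => exact .lt (poly_tval t ρ) (poly_tval u ρ)
  | not _ ih => exact (ih ρ).not
  | and _ _ ih₁ ih₂ => exact (ih₁ ρ).and (ih₂ ρ)
  | or _ _ ih₁ ih₂ => exact (ih₁ ρ).or (ih₂ ρ)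
  | imp _ _ ih₁ ih₂ =>
    convert (ih₁ ρ).not.or (ih₂ ρ) using 2
    exact imp_iff_not_or
  | ball x t _ ih =>
    convert (BddDef.bex (poly_tval t ρ) (ih (upd (fun i => ρ i + 1) x 0)).not).not using 2
    push Not
    simp only [← upd_comp]
    rfl
  | bex x t _ ih =>
    convert BddDef.bex (poly_tval t ρ) (ih (upd (fun i => ρ i + 1) x 0)) using 2
    simp only [← upd_comp]
    rfl

mutual

theorem IsSigma.sigmaDef {N : ℕ} (hC : Collection S.M N) :
    ∀ {k : ℕ} {φ : Fml}, IsSigma k φ → k ≤ N → ∀ ρ : ℕ → ℕ,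
      SigmaDef k fun v : ℕ → S.M => Sat0 S (v ∘ ρ) φ
  | k, _, .delta0 h, _, ρ => SigmaDef.mono (k := 0) (h.bddDef ρ) (Nat.zero_le k)
  | k + 1, _, .ofPi h, hk, ρ => by
    simpa only [not_not] using (IsPi.sigmaDef_not hC h (Nat.le_of_succ_le hk) ρ).not_succ
  | k + 1, _, .ex x (φ := φ) h, hk, ρ => by
    refine SigmaDef.ex (hC.mono (Nat.le_of_succ_le hk))
      (P := fun a v => Sat0 S (upd (v ∘ ρ) x a) φ) ?_
    convert IsSigma.sigmaDef hC h hk (upd (fun i => ρ i + 1) x 0) using 3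
    rw [upd_comp]
    congr 1
    funext i
    cases i <;> rfl

theorem IsPi.sigmaDef_not {N : ℕ} (hC : Collection S.M N) :
    ∀ {k : ℕ} {φ : Fml}, IsPi k φ → k ≤ N → ∀ ρ : ℕ → ℕ,
      SigmaDef k fun v : ℕ → S.M => ¬ Sat0 S (v ∘ ρ) φ
  | k, _, .delta0 h, _, ρ => SigmaDef.mono (k := 0) (h.bddDef ρ).not (Nat.zero_le k)
  | k + 1, _, .ofSigma h, hk, ρ => (IsSigma.sigmaDef hC h (Nat.le_of_succ_le hk) ρ).not_succ
  | k + 1, _, .all x (φ := φ) h, hk, ρ => by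
    convert SigmaDef.ex (hC.mono (Nat.le_of_succ_le hk))
      (P := fun a v => ¬ Sat0 S (upd (v ∘ ρ) x a) φ) ?_ using 2
    · exact not_forall
    convert IsPi.sigmaDef_not hC h hk (upd (fun i => ρ i + 1) x 0) using 4
    rw [upd_comp]
    congr 1
    funext i
    cases i <;> rfl

end

/-! ### Formulas for definable relations -/

theorem Poly.exists_term {f : (ℕ → S.M) → S.M} (hf : Poly f) (σ : ℕ → ℕ) :
    ∃ t, ∀ v, tval S v t = f (v ∘ σ) := by
  induction hf with
  | var i => exact ⟨.var (σ i), fun _ => rfl⟩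
  | zero => exact ⟨.zero, fun _ => rfl⟩
  | one => exact ⟨.one, fun _ => rfl⟩
  | add _ _ ih₁ ih₂ =>
    obtain ⟨t, ht⟩ := ih₁
    obtain ⟨u, hu⟩ := ih₂
    exact ⟨.add t u, fun v => congrArg₂ S.add (ht v) (hu v)⟩
  | mul _ _ ih₁ ih₂ =>
    obtain ⟨t, ht⟩ := ih₁
    obtain ⟨u, hu⟩ := ih₂
    exact ⟨.mul t u, fun v => congrArg₂ S.mul (ht v) (hu v)⟩

theorem BddDef.exists_delta0 {R : (ℕ → S.M) → Prop} (hR : BddDef R) {σ : ℕ → ℕ}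
    (hσ : (Set.range σ)ᶜ.Infinite) : ∃ φ, Delta0 φ ∧ ∀ v, Sat0 S v φ ↔ R (v ∘ σ) := by
  induction hR generalizing σ with
  | eq hf hg =>
    obtain ⟨t, ht⟩ := hf.exists_term σ
    obtain ⟨u, hu⟩ := hg.exists_term σ
    refine ⟨_, .eq t u, fun v => ?_⟩
    simp only [← ht, ← hu]
    rfl
  | lt hf hg =>
    obtain ⟨t, ht⟩ := hf.exists_term σ
    obtain ⟨u, hu⟩ := hg.exists_term σ
    refine ⟨_, .lt t u, fun v => ?_⟩
    simp only [← ht, ← hu]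
    rfl
  | not _ ih =>
    obtain ⟨φ, hφ, h⟩ := ih hσ
    exact ⟨_, hφ.not, fun v => not_congr (h v)⟩
  | and _ _ ih₁ ih₂ =>
    obtain ⟨φ, hφ, h⟩ := ih₁ hσ
    obtain ⟨ψ, hψ, h'⟩ := ih₂ hσ
    exact ⟨_, hφ.and hψ, fun v => and_congr (h v) (h' v)⟩
  | bex hf _ ih =>
    obtain ⟨t, ht⟩ := hf.exists_term σ
    obtain ⟨x, hx⟩ := hσ.nonempty
    obtain ⟨φ, hφ, h⟩ := ih (infinite_compl_range_cons hσ x)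
    refine ⟨_, hφ.bex x t, fun v => exists_congr fun a => ?_⟩
    rw [← ht, ← upd_comp_cons hx, ← h]
    rfl

theorem SigmaDef.exists_isSigma {k : ℕ} {R : (ℕ → S.M) → Prop} (hR : SigmaDef k R) {σ : ℕ → ℕ}
    (hσ : (Set.range σ)ᶜ.Infinite) :
    (∃ φ, IsSigma k φ ∧ ∀ v, Sat0 S v φ ↔ R (v ∘ σ)) ∧
      ∃ φ, IsPi k φ ∧ ∀ v, Sat0 S v φ ↔ ¬ R (v ∘ σ) := by
  induction k generalizing R σ with
  | zero =>
    obtain ⟨φ, hφ, h⟩ := BddDef.exists_delta0 hR hσ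
    exact ⟨⟨φ, .delta0 hφ, h⟩, _, .delta0 hφ.not, fun v => not_congr (h v)⟩
  | succ k ih =>
    obtain ⟨Q, hQ, rfl⟩ := hR
    obtain ⟨x, hx⟩ := hσ.nonempty
    obtain ⟨⟨φ, hφ, h⟩, ψ, hψ, h'⟩ := ih hQ (infinite_compl_range_cons hσ x)
    refine ⟨⟨_, .ex x (.ofPi hψ), fun v => exists_congr fun a => ?_⟩,
      _, .all x (.ofSigma hφ), fun v => ?_⟩
    · rw [← upd_comp_cons hx, ← h']
      rfl
    · push Not
      refine forall_congr' fun a => ?_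
      rw [← upd_comp_cons hx, ← h]
      rfl

theorem bddInduction (hI : IndFor S Delta0) : BddInduction S.M := by
  intro R hR v h0 hs
  have hx : 1 ∉ Set.range fun i => 2 * i := by rintro ⟨i, h⟩; simp only at h; omega
  obtain ⟨φ, hφ, h⟩ := hR.exists_delta0 (infinite_compl_range_cons infinite_compl_range_double 1)
  obtain ⟨v, rfl⟩ := exists_comp_double v
  simp only [← upd_comp_cons hx, ← h] at h0 hs ⊢
  exact hI φ hφ v 1 h0 hs

theorem collection {k : ℕ} (hC : CollFor S (IsSigma k)) : Collection S.M k := by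
  intro R hR v a h0
  have hx : 1 ∉ Set.range fun i => 2 * i := by rintro ⟨i, h⟩; simp only at h; omega
  have hy : 3 ∉ Set.range (cons 1 fun i => 2 * i) := by
    rintro ⟨_ | i, h⟩ <;> simp only [cons] at h <;> omega
  obtain ⟨φ, hφ, h⟩ := (hR.exists_isSigma (infinite_compl_range_cons
    (infinite_compl_range_cons infinite_compl_range_double 1) 3)).1
  obtain ⟨v, rfl⟩ := exists_comp_double v
  simp only [← upd_comp_cons hx, ← upd_comp_cons hy, ← h] at h0 ⊢
  exact hC φ hφ v 1 3 (by decide) a h0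

end Model

/-- Lemma `lem:B->rpi`.
For each `n ∈ ℕ`, `BΣₙ₊₂ ⊢ WRΠₙ₊₁`: every model of `BΣₙ₊₂` satisfies the
weak regularity principle `WRφ` for every `Πₙ₊₁` formula `φ(x,y)` with
parameters. -/
theorem statement_12 (n : ℕ) (S : Str) (h : BSigma S (n + 2)) :
    WRFor S (IsPi (n + 1)) := by
  have : Fact (PAminus S) := ⟨h.1.1⟩
  have hC : Collection S.M (n + 2) := collection h.2
  intro φ hφ v x y _ a h0
  have key (m k : S.M) : upd (upd v x m) y k =
      cons k (cons m v) ∘ upd (upd (fun i => i + 2) x 1) y 0 := by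
    funext i
    simp only [upd, Function.comp]
    split_ifs <;> rfl
  simp only [key] at h0 ⊢
  exact weak_regularity (bddInduction h.1.2) hC (F := fun w => Sat0 S (w ∘ _) φ)
    (hφ.sigmaDef_not hC (Nat.le_succ _) _) v a h0

end PaperArith
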